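/- If the design ξ* is D-optimal, i.e. det M(ξ*) ≥ det M(ξ) for every design ξ, then for every point z ∈ X the prediction variance satisfies d(z,ξ*) ≤ p − Tr( M(ξ*)⁻¹ C ), where d(z,ξ*) = g(z)ᵀ M(ξ*)⁻¹ g(z). -/

import Mathlib

open MeasureTheory Matrix

/-- The information matrix `M(ξ) = ∫_X g(z) g(z)ᵀ dξ(z) + C` of a design `ξ`
(a Borel probability measure on `X ⊆ ℝ^d`), defined entrywise. -/
noncomputable def infoMatrix {d p : ℕ} {X : Set (Fin d → ℝ)}
    (g : (Fin d → ℝ) → Fin p → ℝ) (C : Matrix (Fin p) (Fin p) ℝ)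
    (ξ : Measure X) : Matrix (Fin p) (Fin p) ℝ :=
  Matrix.of fun i j => (∫ z, g (z : Fin d → ℝ) i * g (z : Fin d → ℝ) j ∂ξ) + C i j

/-- The prediction variance `d(z,ξ) = g(z)ᵀ M(ξ)⁻¹ g(z)`. -/
noncomputable def predVar {d p : ℕ} {X : Set (Fin d → ℝ)}
    (g : (Fin d → ℝ) → Fin p → ℝ) (C : Matrix (Fin p) (Fin p) ℝ)
    (ξ : Measure X) (z : Fin d → ℝ) : ℝ :=
  g z ⬝ᵥ ((infoMatrix g C ξ)⁻¹ *ᵥ g z)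


lemma integrable_aux {d p : ℕ} {X : Set (Fin d → ℝ)} (hX : IsCompact X)
    {g : (Fin d → ℝ) → Fin p → ℝ} (hg : Continuous g) (ξ : Measure X) [IsFiniteMeasure ξ]
    (i j : Fin p) :
    Integrable (fun z : X => g (z : Fin d → ℝ) i * g (z : Fin d → ℝ) j) ξ := by
  haveI : CompactSpace X := isCompact_iff_compactSpace.mp hX
  apply Continuous.integrable_of_hasCompactSupport
  · fun_prop
  · exact HasCompactSupport.of_compactSpace _

lemma infoMatrix_posDef {d p : ℕ} {X : Set (Fin d → ℝ)} (hX : IsCompact X)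
    {g : (Fin d → ℝ) → Fin p → ℝ} (hg : Continuous g)
    {C : Matrix (Fin p) (Fin p) ℝ} (hC : C.PosDef) (ξ : Measure X) [IsFiniteMeasure ξ] :
    (infoMatrix g C ξ).PosDef := by
  have h : infoMatrix g C ξ = C + Matrix.of fun i j =>
      (∫ z : X, g (z : Fin d → ℝ) i * g (z : Fin d → ℝ) j ∂ξ) := by
    ext i j
    simp [infoMatrix, add_comm]
  rw [h]
  apply hC.add_posSemidef
  apply Matrix.PosSemidef.of_dotProduct_mulVec_nonneg
  · ext i j
    simp [mul_comm]
  · intro x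
    have : star x ⬝ᵥ ((Matrix.of fun i j =>
      (∫ z : X, g (z : Fin d → ℝ) i * g (z : Fin d → ℝ) j ∂ξ)) *ᵥ x)
        = ∫ z : X, (∑ i, x i * g z i) ^ 2 ∂ξ := by
      have h2 : ∀ z : X, (∑ i, x i * g z i) ^ 2 = ∑ i, ∑ j, (x i * x j) * (g z i * g z j) := by
        intro z
        rw [sq, Finset.sum_mul_sum]
        refine Finset.sum_congr rfl fun i _ => Finset.sum_congr rfl fun j _ => by ring
      simp_rw [h2]
      rw [integral_finsetSum _ fun i _ => integrable_finsetSum _ fun j _ =>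
        (integrable_aux hX hg ξ i j).const_mul _]
      simp only [dotProduct, mulVec, Finset.mul_sum, Matrix.of_apply]
      refine Finset.sum_congr rfl fun i _ => ?_
      rw [integral_finsetSum _ fun j _ => (integrable_aux hX hg ξ i j).const_mul _]
      refine Finset.sum_congr rfl fun j _ => ?_
      rw [integral_const_mul]
      simp
      ring
    rw [this]
    exact integral_nonneg fun z => sq_nonneg _

lemma nonpos_aux (a : ℝ) (q : Polynomial ℝ)
    (h : ∀ t : ℝ, 0 < t → t ≤ 1 → a * t + q.eval t * t ^ 2 ≤ 0) : a ≤ 0 := by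
  have h1 : Filter.Tendsto (fun t : ℝ => a + q.eval t * t) (nhdsWithin 0 (Set.Ioi 0))
      (nhds (a + q.eval 0 * 0)) := by
    apply Filter.Tendsto.mono_left _ nhdsWithin_le_nhds
    exact (by fun_prop : Continuous fun t : ℝ => a + q.eval t * t).tendsto 0
  have h2 := le_of_tendsto h1 (b := 0) (by
    filter_upwards [Ioc_mem_nhdsGT (zero_lt_one' ℝ)] with t ht
    have := h t ht.1 ht.2
    by_contra hc
    push Not at hc
    nlinarith [mul_pos ht.1 hc])
  simpa using h2

/-- If `ξ*` is D-optimal then for every `z ∈ X`,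
`d(z,ξ*) ≤ p − Tr(M(ξ*)⁻¹ C)`. -/
theorem predVar_le_of_DOptimal {d p : ℕ} (hd : 1 ≤ d) (hp : 1 ≤ p)
    {X : Set (Fin d → ℝ)} (hX : IsCompact X)
    {g : (Fin d → ℝ) → Fin p → ℝ} (hg : Continuous g)
    {C : Matrix (Fin p) (Fin p) ℝ} (hC : C.PosDef)
    (ξstar : Measure X) [IsProbabilityMeasure ξstar]
    (hopt : ∀ ξ : Measure X, IsProbabilityMeasure ξ →
      (infoMatrix g C ξ).det ≤ (infoMatrix g C ξstar).det) :
    ∀ z ∈ X, predVar g C ξstar z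
      ≤ (p : ℝ) - Matrix.trace ((infoMatrix g C ξstar)⁻¹ * C) := by
  intro z hz
  have hM := infoMatrix_posDef hX hg hC ξstar
  have hdet := hM.det_pos
  have hu : IsUnit (infoMatrix g C ξstar).det := hdet.ne'.isUnit
  have hmix : ∀ t : ℝ, 0 < t → t ≤ 1 → ∃ ξ : Measure X, IsProbabilityMeasure ξ ∧
      infoMatrix g C ξ = infoMatrix g C ξstar +
        t • (vecMulVec (g z) (g z) + C - infoMatrix g C ξstar) := by
    intro t h0 h1
    refine ⟨ENNReal.ofReal (1 - t) • ξstar + ENNReal.ofReal t • Measure.dirac ⟨z, hz⟩, ⟨?_⟩, ?_⟩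
    · simp only [Measure.add_apply, Measure.smul_apply, measure_univ, smul_eq_mul, mul_one]
      rw [← ENNReal.ofReal_add (by linarith) h0.le]
      simp
    · ext i j
      simp only [infoMatrix, Matrix.of_apply, Matrix.add_apply, Matrix.smul_apply,
        Matrix.sub_apply, vecMulVec_apply, smul_eq_mul]
      rw [integral_add_measure
        ((integrable_aux hX hg ξstar i j).smul_measure ENNReal.ofReal_ne_top)
        ((integrable_aux hX hg _ i j).smul_measure ENNReal.ofReal_ne_top),
        integral_smul_measure, integral_smul_measure, integral_dirac,
        ENNReal.toReal_ofReal (by linarith), ENNReal.toReal_ofReal h0.le]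
      simp only [smul_eq_mul]
      ring
  set M := infoMatrix g C ξstar with hMdef
  set D := vecMulVec (g z) (g z) + C - M with hD
  have htr : (M⁻¹ * D).trace = predVar g C ξstar z + (M⁻¹ * C).trace - p := by
    rw [hD, Matrix.mul_sub, Matrix.mul_add, Matrix.nonsing_inv_mul _ hu, trace_sub, trace_add,
      mul_vecMulVec, trace_vecMulVec, trace_one, Fintype.card_fin, predVar, ← hMdef,
      dotProduct_comm]
  have key : (M⁻¹ * D).trace ≤ 0 := by
    apply nonpos_aux _ (det (1 + (Polynomial.X : Polynomial ℝ) • (M⁻¹ * D).map Polynomial.C)).divX.divX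
    intro t h0 h1
    obtain ⟨ξ, hξ, he⟩ := hmix t h0 h1
    have h2 := hopt ξ hξ
    have h3 : M + t • D = M * (1 + t • (M⁻¹ * D)) := by
      rw [Matrix.mul_add, Matrix.mul_one, Matrix.mul_smul, Matrix.mul_nonsing_inv_cancel_left _ _ hu]
    rw [he, h3, det_mul, det_one_add_smul] at h2
    have h4 := (mul_le_iff_le_one_right hdet).mp h2
    linarith
  linarith
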